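/- Let R be an order in a number field K whose conductor is P = π𝓞_K, a principal prime ideal of 𝓞_K with π ∈ R. Let D ∈ ℕ be such that every multiset of D elements of Cl(R) has a nonempty submultiset whose sum is zero. If β ∈ 𝓞_K is nonzero, not a unit of 𝓞_K, and no nonunit element of R divides β in 𝓞_K, then every multiset of prime ideals of 𝓞_K whose product equals β𝓞_K has cardinality at most D−1. -/

import Mathlib

set_option synthInstance.maxHeartbeats 1000000
set_option maxHeartbeats 1000000

open NumberField

/-- The conductor of a subring `R` of the ring of integers `𝓞 K`:
the set of `x ∈ 𝓞 K` such that `x • 𝓞 K ⊆ R`, as an ideal of `𝓞 K`. -/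
noncomputable def conductorIdeal {K : Type*} [Field K] [NumberField K] (R : Subring (𝓞 K)) :
    Ideal (𝓞 K) where
  carrier := {x | ∀ y : 𝓞 K, x * y ∈ R}
  add_mem' := fun {a b} ha hb y => by
    simpa [add_mul] using R.add_mem (ha y) (hb y)
  zero_mem' := fun y => by simpa using R.zero_mem
  smul_mem' := fun c x hx y => by
    simpa [smul_eq_mul, mul_comm, mul_assoc, mul_left_comm] using hx (c * y)

open scoped nonZeroDivisors

theorem mem_of_conductor {K : Type*} [Field K] [NumberField K] (R : Subring (𝓞 K))
    {x : 𝓞 K} (hx : x ∈ conductorIdeal R) : x ∈ R := by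
  have := hx 1
  simpa using this

theorem conductor_ne_bot {K : Type*} [Field K] [NumberField K] (R : Subring (𝓞 K))
    (hR : Finite ((𝓞 K) ⧸ R.toAddSubgroup)) : conductorIdeal R ≠ ⊥ := by
  intro h
  have hn : R.toAddSubgroup.index ≠ 0 := AddSubgroup.index_ne_zero_of_finite
  have hmem : ((R.toAddSubgroup.index : ℕ) : 𝓞 K) ∈ conductorIdeal R := by
    intro y
    have := AddSubgroup.nsmul_index_mem R.toAddSubgroup y
    rw [nsmul_eq_mul] at this
    exact this
  rw [h, Ideal.mem_bot] at hmem
  exact hn (by exact_mod_cast hmem)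

theorem mem_mul_conductor {K : Type*} [Field K] [NumberField K] (R : Subring (𝓞 K))
    (Q I : Ideal (𝓞 K)) {x : 𝓞 K}
    (hx : x ∈ (Q * conductorIdeal R) * (I * conductorIdeal R)) :
    ∃ r ∈ Q.comap R.subtype * I.comap R.subtype, (r : 𝓞 K) = x := by
  refine Submodule.mul_induction_on hx ?_ ?_
  · intro m hm n hn
    have hm' := mem_of_conductor R (Ideal.mul_le_right hm)
    have hn' := mem_of_conductor R (Ideal.mul_le_right hn)
    refine ⟨⟨m, hm'⟩ * ⟨n, hn'⟩, Ideal.mul_mem_mul ?_ ?_, rfl⟩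
    · exact Ideal.mul_le_left (I := Q) hm
    · exact Ideal.mul_le_left (I := I) hn
  · rintro x y ⟨r, hr, rfl⟩ ⟨s, hs, rfl⟩
    exact ⟨r + s, add_mem hr hs, rfl⟩

theorem comap_mul_eq_span {K : Type*} [Field K] [NumberField K] (R : Subring (𝓞 K))
    (Q I : Ideal (𝓞 K)) (a : R) (ha : 1 - (a : 𝓞 K) ∈ conductorIdeal R)
    (hQI : Ideal.span {(a : 𝓞 K)} = Q * I) :
    Q.comap R.subtype * I.comap R.subtype = Ideal.span {a} := by
  have haQI : (a : 𝓞 K) ∈ Q * I := hQI ▸ Ideal.mem_span_singleton_self _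
  apply le_antisymm
  · rw [Ideal.mul_le]
    intro r hr s hs
    have h : ((r * s : R) : 𝓞 K) ∈ Q * I := Ideal.mul_mem_mul hr hs
    rw [← hQI, Ideal.mem_span_singleton] at h
    obtain ⟨y, hy⟩ := h
    have hyR : y ∈ R := by
      have h1 : y = ((r * s : R) : 𝓞 K) + (1 - (a : 𝓞 K)) * y := by rw [hy]; ring
      rw [h1]
      exact R.add_mem (r * s).2 (ha y)
    rw [Ideal.mem_span_singleton]
    exact ⟨⟨y, hyR⟩, Subtype.ext hy⟩
  · rw [Ideal.span_singleton_le_iff_mem]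
    obtain ⟨r, hr, hra⟩ := mem_mul_conductor R Q I
      (x := (a : 𝓞 K) * ((1 - a) * (1 - a))) (by
        rw [mul_mul_mul_comm]
        exact Ideal.mul_mem_mul haQI (Ideal.mul_mem_mul ha ha))
    have e : a = r + a * a * (1 + 1 - a) := by
      apply Subtype.ext
      push_cast
      rw [hra]
      ring
    rw [e]
    refine add_mem hr (Ideal.mul_mem_right _ _ (Ideal.mul_mem_mul ?_ ?_))
    · exact Ideal.mul_le_left (I := Q) haQI
    · exact Ideal.mul_le_right (J := I) haQI

theorem exists_mem_of_coprime {K : Type*} [Field K] [NumberField K] (R : Subring (𝓞 K))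
    (Q : Ideal (𝓞 K)) (h : Q ⊔ conductorIdeal R = ⊤) :
    ∃ a : R, (a : 𝓞 K) ∈ Q ∧ 1 - (a : 𝓞 K) ∈ conductorIdeal R := by
  obtain ⟨i, hi, j, hj, hij⟩ :=
    Ideal.isCoprime_iff_exists.mp (Ideal.isCoprime_iff_sup_eq.mpr h)
  have hi' : i = 1 - j := by rw [← hij]; ring
  have hiR : i ∈ R := by
    rw [hi']
    exact R.sub_mem R.one_mem (mem_of_conductor R hj)
  refine ⟨⟨i, hiR⟩, hi, ?_⟩
  have : 1 - i = j := by rw [← hij]; ring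
  simpa [this] using hj

theorem isUnit_comap {K : Type*} [Field K] [NumberField K] (R : Subring (𝓞 K))
    (hP : conductorIdeal R ≠ ⊤)
    (Q : Ideal (𝓞 K)) (h : Q ⊔ conductorIdeal R = ⊤) :
    IsUnit ((Q.comap R.subtype : Ideal R) : FractionalIdeal R⁰ (FractionRing R)) := by
  obtain ⟨a, haQ, haP⟩ := exists_mem_of_coprime R Q h
  have ha0 : a ≠ 0 := by
    rintro rfl
    exact hP ((Ideal.eq_top_iff_one _).mpr (by simpa using haP))
  obtain ⟨I, hI⟩ := Ideal.dvd_span_singleton.mpr haQ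
  have hmul := comap_mul_eq_span R Q I a haP hI
  apply isUnit_of_mul_isUnit_left
    (y := ((I.comap R.subtype : Ideal R) : FractionalIdeal R⁰ (FractionRing R)))
  rw [← FractionalIdeal.coeIdeal_mul, hmul, FractionalIdeal.coeIdeal_span_singleton]
  have hne : algebraMap R (FractionRing R) a ≠ 0 := by
    simpa using ha0
  apply IsUnit.of_mul_eq_one (FractionalIdeal.spanSingleton R⁰ (algebraMap R (FractionRing R) a)⁻¹)
  rw [FractionalIdeal.spanSingleton_mul_spanSingleton, mul_inv_cancel₀ hne,
    FractionalIdeal.spanSingleton_one]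

theorem map_comap_coprime {K : Type*} [Field K] [NumberField K] (R : Subring (𝓞 K))
    (Q : Ideal (𝓞 K)) (h : Q ⊔ conductorIdeal R = ⊤) :
    (Q.comap R.subtype).map R.subtype = Q := by
  apply le_antisymm Ideal.map_comap_le
  intro x hx
  obtain ⟨a, haQ, haP⟩ := exists_mem_of_coprime R Q h
  have e : x = x * a + (1 - a) * x := by ring
  rw [e]
  refine add_mem (Ideal.mul_mem_left _ _ ?_) ?_
  · exact Ideal.mem_map_of_mem R.subtype (x := a) haQ
  · exact Ideal.mem_map_of_mem R.subtype (x := ⟨(1 - a) * x, haP x⟩)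
      (I := Q.comap R.subtype)
      (Ideal.mul_mem_left Q (1 - (a : 𝓞 K)) hx)

theorem exists_le_of_le_map {α γ : Type*} (f : α → γ) (s : Multiset α) (t : Multiset γ)
    (h : t ≤ s.map f) : ∃ u ≤ s, u.map f = t := by
  induction s using Quotient.inductionOn with
  | h l =>
    induction t using Quotient.inductionOn with
    | h m =>
      obtain ⟨m', hm', hsub⟩ := (h : m.Subperm (l.map f))
      obtain ⟨l', hl', rfl⟩ := List.sublist_map_iff.mp hsub
      refine ⟨(l' : Multiset α), hl'.subperm, ?_⟩
      exact Quotient.sound hm'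

theorem exists_le_card_eq {α : Type*} (s : Multiset α) (n : ℕ) (h : n ≤ Multiset.card s) :
    ∃ t ≤ s, Multiset.card t = n := by
  induction s using Quotient.inductionOn with
  | h l =>
    refine ⟨(l.take n : List α), (List.take_sublist n l).subperm, ?_⟩
    have h' : n ≤ l.length := h
    simpa using h'

/-- The class of the contraction of an ideal, when it is invertible. -/
noncomputable def contractClass {K : Type*} [Field K] [NumberField K] (R : Subring (𝓞 K))
    (hP : conductorIdeal R ≠ ⊤) (Q : {Q : Ideal (𝓞 K) // Q ⊔ conductorIdeal R = ⊤}) :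
    (FractionalIdeal R⁰ (FractionRing R))ˣ :=
  (isUnit_comap R hP Q.1 Q.2).unit

/-- If the conductor of the order `R` is a principal prime ideal `π𝓞_K` with `π ∈ R`,
every multiset of `D` elements of `Cl(R)` has a nonempty zero-sum (product-one)
submultiset, and `β ∈ 𝓞 K` is a nonzero nonunit with no nonunit divisor from `R`, then
any factorization of `β𝓞_K` into prime ideals of `𝓞 K` has at most `D - 1` factors. -/
theorem stmt_16 {K : Type*} [Field K] [NumberField K] (R : Subring (𝓞 K))
    (hR : Finite ((𝓞 K) ⧸ R.toAddSubgroup))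
    (π : R)
    (hPprime : (conductorIdeal R).IsPrime)
    (hPeq : conductorIdeal R = Ideal.span {(π : 𝓞 K)})
    (D : ℕ)
    (hD : ∀ S : Multiset (ClassGroup R), Multiset.card S = D →
      ∃ T ≤ S, T ≠ 0 ∧ T.prod = 1)
    (β : 𝓞 K) (hβ0 : β ≠ 0) (hβu : ¬IsUnit β)
    (hβ : ∀ r : R, ¬IsUnit r → ¬((r : 𝓞 K) ∣ β))
    (S : Multiset (Ideal (𝓞 K))) (hSprime : ∀ P ∈ S, P.IsPrime)
    (hSprod : S.prod = Ideal.span {β}) :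
    Multiset.card S ≤ D - 1 := by
  classical
  by_contra hcard
  have hDpos : D ≠ 0 := by
    rintro rfl
    obtain ⟨T, hT, hT0, -⟩ := hD 0 rfl
    exact hT0 (Multiset.le_zero.mp hT)
  have hDS : D ≤ Multiset.card S := by omega
  have hPtop : conductorIdeal R ≠ ⊤ := hPprime.ne_top
  have hPbot := conductor_ne_bot R hR
  have hπu : ¬ IsUnit π := by
    intro hu
    apply hPtop
    rw [hPeq, Ideal.span_singleton_eq_top]
    exact hu.map R.subtype
  have hcop : ∀ Q ∈ S, Q ⊔ conductorIdeal R = ⊤ := by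
    intro Q hQ
    have hdvd : Q ∣ Ideal.span {β} := hSprod ▸ Multiset.dvd_prod hQ
    have hQ0 : Q ≠ ⊥ := by
      rintro rfl
      have h1 := Ideal.dvd_span_singleton.mp hdvd
      exact hβ0 (by simpa using h1)
    have hQm : Q.IsMaximal := (hSprime Q hQ).isMaximal hQ0
    have hPm : (conductorIdeal R).IsMaximal := hPprime.isMaximal hPbot
    refine hQm.coprime_of_ne hPm ?_
    rintro rfl
    have h1 := Ideal.dvd_span_singleton.mp hdvd
    rw [hPeq, Ideal.mem_span_singleton] at h1
    exact hβ π hπu h1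
  obtain ⟨S₁, hS₁, hS₁c⟩ := exists_le_card_eq S D hDS
  have hcop₁ : ∀ Q ∈ S₁, Q ⊔ conductorIdeal R = ⊤ :=
    fun Q hQ => hcop Q (Multiset.mem_of_le hS₁ hQ)
  lift S₁ to Multiset {Q : Ideal (𝓞 K) // Q ⊔ conductorIdeal R = ⊤} using hcop₁
  obtain ⟨T, hT, hT0, hTp⟩ := hD
    (S₁.map (fun Q => ClassGroup.mk (FractionRing R) (contractClass R hPtop Q)))
    (by simpa using hS₁c)
  obtain ⟨U, hU, rfl⟩ := exists_le_of_le_map _ _ _ hT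
  have hU0 : U ≠ 0 := by
    rintro rfl
    exact hT0 rfl
  have hprod : ClassGroup.mk (FractionRing R) (U.map (contractClass R hPtop)).prod = 1 := by
    rw [map_multiset_prod, Multiset.map_map]
    exact hTp
  have hcoe : (((U.map (contractClass R hPtop)).prod :
      (FractionalIdeal R⁰ (FractionRing R))ˣ) : FractionalIdeal R⁰ (FractionRing R)) =
      ((U.map (fun Q => Q.1.comap R.subtype)).prod : Ideal R) := by
    have h1 := map_multiset_prod (Units.coeHom (FractionalIdeal R⁰ (FractionRing R)))
      (U.map (contractClass R hPtop))
    have h2 := map_multiset_prod (FractionalIdeal.coeIdealHom R⁰ (FractionRing R))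
      (U.map (fun Q => Q.1.comap R.subtype))
    rw [Multiset.map_map] at h1 h2
    exact h1.trans h2.symm
  obtain ⟨r, hr0, hr⟩ := (ClassGroup.mk_eq_one_of_coe_ideal hcoe).mp hprod
  have hext : (U.map Subtype.val).prod = Ideal.span {(r : 𝓞 K)} := by
    have h1 := congrArg (Ideal.map R.subtype) hr
    rw [Ideal.map_span, Set.image_singleton] at h1
    have h2 := map_multiset_prod (Ideal.mapHom R.subtype)
      (U.map (fun Q => Q.1.comap R.subtype))
    rw [Multiset.map_map] at h2
    have h3 : U.map (Ideal.mapHom R.subtype ∘ fun Q => Q.1.comap R.subtype)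
        = U.map Subtype.val :=
      Multiset.map_congr rfl (fun Q _ => map_comap_coprime R Q.1 Q.2)
    rw [h3] at h2
    exact h2.symm.trans h1
  have hUS : U.map Subtype.val ≤ S := (Multiset.map_le_map hU).trans hS₁
  refine hβ r ?_ ?_
  · intro hu
    have hu' : IsUnit (r : 𝓞 K) := hu.map R.subtype
    rw [Ideal.span_singleton_eq_top.mpr hu'] at hext
    obtain ⟨Q, hQ⟩ := Multiset.exists_mem_of_ne_zero hU0
    have hQm : Q.1 ∈ U.map Subtype.val := Multiset.mem_map_of_mem _ hQ
    have hle : (U.map Subtype.val).prod ≤ Q.1 := Ideal.le_of_dvd (Multiset.dvd_prod hQm)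
    rw [hext] at hle
    exact (hSprime _ (Multiset.mem_of_le hUS hQm)).ne_top (top_le_iff.mp hle)
  · have hd := Multiset.prod_dvd_prod_of_le hUS
    rw [hext, hSprod] at hd
    exact Ideal.mem_span_singleton.mp (Ideal.dvd_span_singleton.mp hd)
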